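/- arXiv:1310.6528 — 2 statements merged into one kernel-verified Lean document; each statement's English description precedes it below -/
import Mathlib

section
/- Fix a ∈ ℕ, a ≥ 1, and for n ≥ 1 let Ĝ_n^a = Ĝ(n, an) be the disconnected in-out bridge graph. Then the Pearson In/Out correlation coefficient satisfies lim_{n→∞} r_-^+(Ĝ_n^a) = 0. -/
open Filter Topology

/-- Vertices of the disconnected in-out bridge graph `Ĝ(k, m)`: `Sum.inl i` is `vᵢ`,
`Sum.inr (Sum.inl j)` is `wⱼ`, `Sum.inr (Sum.inr 0)` is `v`, `Sum.inr (Sum.inr 1)`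
is `w` and `Sum.inr (Sum.inr 2)` is the extra vertex `u`. -/
abbrev HBridgeV (k m : ℕ) := Fin k ⊕ (Fin m ⊕ Fin 3)

/-- Edges of `Ĝ(k, m)`: `Sum.inl i` is `eᵢ = (vᵢ, v)`, `Sum.inr (Sum.inl j)` is
`fⱼ = (w, wⱼ)`, `Sum.inr (Sum.inr 0)` is `g₁ = (v, u)` and `Sum.inr (Sum.inr 1)`
is `g₂ = (u, w)`. -/
abbrev HBridgeE (k m : ℕ) := Fin k ⊕ (Fin m ⊕ Fin 2)

/-- The vertex `v` of `Ĝ(k, m)`. -/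
def hbv (k m : ℕ) : HBridgeV k m := Sum.inr (Sum.inr 0)

/-- The vertex `w` of `Ĝ(k, m)`. -/
def hbw (k m : ℕ) : HBridgeV k m := Sum.inr (Sum.inr 1)

/-- The vertex `u` of `Ĝ(k, m)`. -/
def hbu (k m : ℕ) : HBridgeV k m := Sum.inr (Sum.inr 2)

/-- Source map of `Ĝ(k, m)`. -/
def hbsrc (k m : ℕ) : HBridgeE k m → HBridgeV k m
  | Sum.inl i => Sum.inl i
  | Sum.inr (Sum.inl _) => hbw k m
  | Sum.inr (Sum.inr ⟨0, _⟩) => hbv k m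
  | Sum.inr (Sum.inr ⟨_ + 1, _⟩) => hbu k m

/-- Target map of `Ĝ(k, m)`. -/
def hbtgt (k m : ℕ) : HBridgeE k m → HBridgeV k m
  | Sum.inl _ => hbv k m
  | Sum.inr (Sum.inl j) => Sum.inr (Sum.inl j)
  | Sum.inr (Sum.inr ⟨0, _⟩) => hbu k m
  | Sum.inr (Sum.inr ⟨_ + 1, _⟩) => hbw k m

/-- Out-degree in `Ĝ(k, m)`. -/
noncomputable def hbOut (k m : ℕ) (x : HBridgeV k m) : ℕ :=
  Nat.card {e : HBridgeE k m // hbsrc k m e = x}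

/-- In-degree in `Ĝ(k, m)`. -/
noncomputable def hbIn (k m : ℕ) (x : HBridgeV k m) : ℕ :=
  Nat.card {e : HBridgeE k m // hbtgt k m e = x}

/-- `|Ê(k, m)|` as a real number. -/
noncomputable def hbnE (k m : ℕ) : ℝ := (Fintype.card (HBridgeE k m) : ℝ)

/-- `σ₋(Ĝ(k,m))`. -/
noncomputable def hbSigmaMinus (k m : ℕ) : ℝ :=
  Real.sqrt ((hbnE k m)⁻¹ * ∑ x : HBridgeV k m, (hbOut k m x : ℝ) * (hbIn k m x : ℝ) ^ 2
    - ((hbnE k m) ^ 2)⁻¹ * (∑ x : HBridgeV k m, (hbOut k m x : ℝ) * (hbIn k m x : ℝ)) ^ 2)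

/-- `σ⁺(Ĝ(k,m))`. -/
noncomputable def hbSigmaPlus (k m : ℕ) : ℝ :=
  Real.sqrt ((hbnE k m)⁻¹ * ∑ x : HBridgeV k m, (hbIn k m x : ℝ) * (hbOut k m x : ℝ) ^ 2
    - ((hbnE k m) ^ 2)⁻¹ * (∑ x : HBridgeV k m, (hbIn k m x : ℝ) * (hbOut k m x : ℝ)) ^ 2)

/-- Pearson's In/Out correlation coefficient `r₋⁺(Ĝ(k,m))`. -/
noncomputable def hbPearsonInOut (k m : ℕ) : ℝ :=
  (hbSigmaMinus k m * hbSigmaPlus k m)⁻¹ *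
    ((hbnE k m)⁻¹ *
        ∑ e : HBridgeE k m, (hbIn k m (hbsrc k m e) : ℝ) * (hbOut k m (hbtgt k m e) : ℝ)
      - ((hbnE k m) ^ 2)⁻¹ *
          (∑ x : HBridgeV k m, (hbOut k m x : ℝ) * (hbIn k m x : ℝ)) *
          (∑ x : HBridgeV k m, (hbIn k m x : ℝ) * (hbOut k m x : ℝ)))

open Classical in
lemma hbOut_eq_sum (k m : ℕ) (x : HBridgeV k m) :
    hbOut k m x = ∑ e : HBridgeE k m, if hbsrc k m e = x then 1 else 0 := by
  rw [hbOut, Nat.card_eq_fintype_card, Fintype.card_subtype, Finset.card_filter]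

open Classical in
lemma hbIn_eq_sum (k m : ℕ) (x : HBridgeV k m) :
    hbIn k m x = ∑ e : HBridgeE k m, if hbtgt k m e = x then 1 else 0 := by
  rw [hbIn, Nat.card_eq_fintype_card, Fintype.card_subtype, Finset.card_filter]

lemma hbOut_inl (k m : ℕ) (i : Fin k) : hbOut k m (Sum.inl i) = 1 := by
  simp [hbOut_eq_sum, hbsrc, hbv, hbw, hbu, Fin.sum_univ_two]

lemma hbOut_inr_inl (k m : ℕ) (j : Fin m) : hbOut k m (Sum.inr (Sum.inl j)) = 0 := by
  simp [hbOut_eq_sum, hbsrc, hbv, hbw, hbu, Fin.sum_univ_two]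

lemma hbOut_hbv (k m : ℕ) : hbOut k m (hbv k m) = 1 := by
  simp [hbOut_eq_sum, hbsrc, hbv, hbw, hbu, Fin.sum_univ_two]

lemma hbOut_hbw (k m : ℕ) : hbOut k m (hbw k m) = m := by
  simp [hbOut_eq_sum, hbsrc, hbv, hbw, hbu, Fin.sum_univ_two]

lemma hbOut_hbu (k m : ℕ) : hbOut k m (hbu k m) = 1 := by
  simp [hbOut_eq_sum, hbsrc, hbv, hbw, hbu, Fin.sum_univ_two]

lemma hbIn_inl (k m : ℕ) (i : Fin k) : hbIn k m (Sum.inl i) = 0 := by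
  simp [hbIn_eq_sum, hbtgt, hbv, hbw, hbu, Fin.sum_univ_two]

lemma hbIn_inr_inl (k m : ℕ) (j : Fin m) : hbIn k m (Sum.inr (Sum.inl j)) = 1 := by
  simp [hbIn_eq_sum, hbtgt, hbv, hbw, hbu, Fin.sum_univ_two]

lemma hbIn_hbv (k m : ℕ) : hbIn k m (hbv k m) = k := by
  simp [hbIn_eq_sum, hbtgt, hbv, hbw, hbu, Fin.sum_univ_two]

lemma hbIn_hbw (k m : ℕ) : hbIn k m (hbw k m) = 1 := by
  simp [hbIn_eq_sum, hbtgt, hbv, hbw, hbu, Fin.sum_univ_two]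

lemma hbIn_hbu (k m : ℕ) : hbIn k m (hbu k m) = 1 := by
  simp [hbIn_eq_sum, hbtgt, hbv, hbw, hbu, Fin.sum_univ_two]

lemma hbnE_eq (k m : ℕ) : hbnE k m = k + m + 2 := by
  simp [hbnE, add_assoc]

lemma sum_hBridgeV (k m : ℕ) (F : HBridgeV k m → ℝ) :
    ∑ x, F x = (∑ i, F (Sum.inl i)) + (∑ j, F (Sum.inr (Sum.inl j))) +
      (F (hbv k m) + F (hbw k m) + F (hbu k m)) := by
  rw [Fintype.sum_sum_type, Fintype.sum_sum_type, Fin.sum_univ_three, ← add_assoc]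
  rfl

lemma sum_hbOut_mul_hbIn (k m : ℕ) :
    ∑ x : HBridgeV k m, (hbOut k m x : ℝ) * (hbIn k m x : ℝ) = k + m + 1 := by
  rw [sum_hBridgeV]
  simp [hbOut_inl, hbOut_inr_inl, hbOut_hbv, hbOut_hbw, hbOut_hbu,
    hbIn_inl, hbIn_inr_inl, hbIn_hbv, hbIn_hbw, hbIn_hbu]

lemma sum_hbOut_mul_hbIn_sq (k m : ℕ) :
    ∑ x : HBridgeV k m, (hbOut k m x : ℝ) * (hbIn k m x : ℝ) ^ 2 = k ^ 2 + m + 1 := by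
  rw [sum_hBridgeV]
  simp [hbOut_inl, hbOut_inr_inl, hbOut_hbv, hbOut_hbw, hbOut_hbu,
    hbIn_inl, hbIn_inr_inl, hbIn_hbv, hbIn_hbw, hbIn_hbu]

lemma sum_hbIn_mul_hbOut_sq (k m : ℕ) :
    ∑ x : HBridgeV k m, (hbIn k m x : ℝ) * (hbOut k m x : ℝ) ^ 2 = k + m ^ 2 + 1 := by
  rw [sum_hBridgeV]
  simp [hbOut_inl, hbOut_inr_inl, hbOut_hbv, hbOut_hbw, hbOut_hbu,
    hbIn_inl, hbIn_inr_inl, hbIn_hbv, hbIn_hbw, hbIn_hbu]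

lemma sum_hbIn_hbsrc_mul_hbOut_hbtgt (k m : ℕ) :
    ∑ e : HBridgeE k m, (hbIn k m (hbsrc k m e) : ℝ) * (hbOut k m (hbtgt k m e) : ℝ)
      = k + m := by
  simp [Fin.sum_univ_two, hbsrc, hbtgt, hbOut_inr_inl, hbOut_hbv, hbOut_hbw, hbOut_hbu,
    hbIn_inl, hbIn_hbv, hbIn_hbw, hbIn_hbu]

lemma hbPearsonInOut_eq (k m : ℕ) :
    hbPearsonInOut k m =
      -((hbSigmaMinus k m * hbSigmaPlus k m)⁻¹ * (((k : ℝ) + m + 2) ^ 2)⁻¹) := by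
  have hE : (k : ℝ) + m + 2 ≠ 0 := by positivity
  have hcomm : ∑ x : HBridgeV k m, (hbIn k m x : ℝ) * (hbOut k m x : ℝ) = k + m + 1 := by
    simpa only [mul_comm] using sum_hbOut_mul_hbIn k m
  rw [hbPearsonInOut, sum_hbIn_hbsrc_mul_hbOut_hbtgt, sum_hbOut_mul_hbIn, hcomm, hbnE_eq,
    ← mul_neg]
  congr 1
  field_simp
  ring

lemma one_le_sqrt_inv_mul_sub {E S : ℝ} (hE : 1 ≤ E) (hS : 2 * E ≤ S) :
    1 ≤ Real.sqrt (E⁻¹ * S - (E ^ 2)⁻¹ * (E - 1) ^ 2) := by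
  have hE0 : 0 < E := by linarith
  rw [Real.one_le_sqrt]
  have h1 : 2 ≤ E⁻¹ * S := by
    rw [inv_mul_eq_div, le_div_iff₀ hE0]
    exact hS
  have h2 : (E ^ 2)⁻¹ * (E - 1) ^ 2 ≤ 1 := by
    rw [inv_mul_eq_div, div_le_one (by positivity)]
    nlinarith
  linarith

lemma one_le_hbSigmaMinus {k m : ℕ} (h : 2 * ((k : ℝ) + m + 2) ≤ k ^ 2 + m + 1) :
    1 ≤ hbSigmaMinus k m := by
  have hE : (1 : ℝ) ≤ k + m + 2 := by
    have : (0 : ℝ) ≤ k + m := by positivity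
    linarith
  have := one_le_sqrt_inv_mul_sub hE h
  rw [hbSigmaMinus, sum_hbOut_mul_hbIn, sum_hbOut_mul_hbIn_sq, hbnE_eq]
  convert this using 5
  ring

lemma one_le_hbSigmaPlus {k m : ℕ} (h : 2 * ((k : ℝ) + m + 2) ≤ k + m ^ 2 + 1) :
    1 ≤ hbSigmaPlus k m := by
  have hE : (1 : ℝ) ≤ k + m + 2 := by
    have : (0 : ℝ) ≤ k + m := by positivity
    linarith
  have := one_le_sqrt_inv_mul_sub hE h
  have hcomm : ∑ x : HBridgeV k m, (hbIn k m x : ℝ) * (hbOut k m x : ℝ) = k + m + 1 := by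
    simpa only [mul_comm] using sum_hbOut_mul_hbIn k m
  rw [hbSigmaPlus, hcomm, sum_hbIn_mul_hbOut_sq, hbnE_eq]
  convert this using 5
  ring

/-- For the disconnected in-out bridge graphs `Ĝₙᵃ = Ĝ(n, an)` with `a ≥ 1` fixed,
Pearson's In/Out correlation coefficient tends to `0` as `n → ∞`. -/
theorem pearson_in_out_disconnected_bridge (a : ℕ) (ha : 1 ≤ a) :
    Tendsto (fun n : ℕ => hbPearsonInOut n (a * n)) atTop (𝓝 0) := by
  refine squeeze_zero_norm' ?_ tendsto_inv_atTop_nhds_zero_nat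
  filter_upwards [eventually_ge_atTop (a + 4)] with n hn
  have ha' : (1 : ℝ) ≤ a := by exact_mod_cast ha
  have hn' : (a : ℝ) + 4 ≤ n := by exact_mod_cast hn
  have hm : (n : ℝ) ≤ ((a * n : ℕ) : ℝ) := by exact_mod_cast Nat.le_mul_of_pos_left n ha
  have hσ : 1 ≤ hbSigmaMinus n (a * n) := by
    apply one_le_hbSigmaMinus
    push_cast
    nlinarith
  have hτ : 1 ≤ hbSigmaPlus n (a * n) := by
    apply one_le_hbSigmaPlus
    nlinarith
  have hστ : 1 ≤ hbSigmaMinus n (a * n) * hbSigmaPlus n (a * n) :=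
    one_le_mul_of_one_le_of_one_le hσ hτ
  rw [hbPearsonInOut_eq, norm_neg, Real.norm_of_nonneg (by positivity)]
  calc _ ≤ 1 * (((n : ℝ) + (a * n : ℕ) + 2) ^ 2)⁻¹ := by
        gcongr
        exact inv_le_one_of_one_le₀ hστ
    _ ≤ (n : ℝ)⁻¹ := by
        rw [one_mul]
        have hn0 : (0 : ℝ) < n := by linarith
        gcongr
        nlinarith
end

section
/- Fix a ∈ ℕ, a ≥ 1, and for n ≥ 1 let G_n^a = G(n, an) be the in-out bridge graph. Resolve ties by the index-order ranking: R^+((e_i)^*) = an + i, R^-((e_i)_*) = i for 1 ≤ i ≤ n; R^+((f_j)^*) = j, R^-((f_j)_*) = n + j for 1 ≤ j ≤ an; R^+(g^*) = R^-(g_*) = 1 + (a+1)n. Then Spearman's rho computed from these ranks equals ρ_-^+(G_n^a) = ((a^3 − 3a^2 − 3a + 1)n^3 + 3(a+1)^2 n^2 + 2(a+1)n)/((a^3 + 3a^2 + 3a + 1)n^3 + 3(a+1)^2 n^2 + 2(a+1)n), and consequently lim_{n→∞} ρ_-^+(G_n^a) = (a^3 − 3a^2 − 3a + 1)/(a+1)^3.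 -/
open Filter Topology

/-- Vertices of the in-out bridge graph `G(k, m)`: `Sum.inl i` is `vᵢ`,
`Sum.inr (Sum.inl j)` is `wⱼ`, `Sum.inr (Sum.inr 0)` is `v` and
`Sum.inr (Sum.inr 1)` is `w`. -/
abbrev BridgeV (k m : ℕ) := Fin k ⊕ (Fin m ⊕ Fin 2)

/-- Edges of the in-out bridge graph `G(k, m)`: `Sum.inl i` is `eᵢ = (vᵢ, v)`,
`Sum.inr (Sum.inl j)` is `fⱼ = (w, wⱼ)` and `Sum.inr (Sum.inr ())` is `g = (v, w)`. -/
abbrev BridgeE (k m : ℕ) := Fin k ⊕ (Fin m ⊕ Unit)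

/-- The bridge vertex `v`. -/
def bv (k m : ℕ) : BridgeV k m := Sum.inr (Sum.inr 0)

/-- The bridge vertex `w`. -/
def bw (k m : ℕ) : BridgeV k m := Sum.inr (Sum.inr 1)

/-- Source map of `G(k, m)`. -/
def bsrc (k m : ℕ) : BridgeE k m → BridgeV k m
  | Sum.inl i => Sum.inl i
  | Sum.inr (Sum.inl _) => bw k m
  | Sum.inr (Sum.inr _) => bv k m

/-- Target map of `G(k, m)`. -/
def btgt (k m : ℕ) : BridgeE k m → BridgeV k m
  | Sum.inl _ => bv k m
  | Sum.inr (Sum.inl j) => Sum.inr (Sum.inl j)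
  | Sum.inr (Sum.inr _) => bw k m

/-- Out-degree in `G(k, m)`. -/
noncomputable def bOut (k m : ℕ) (x : BridgeV k m) : ℕ :=
  Nat.card {e : BridgeE k m // bsrc k m e = x}

/-- In-degree in `G(k, m)`. -/
noncomputable def bIn (k m : ℕ) (x : BridgeV k m) : ℕ :=
  Nat.card {e : BridgeE k m // btgt k m e = x}

/-- `|E(k, m)|` as a real number. -/
noncomputable def bnE (k m : ℕ) : ℝ := (Fintype.card (BridgeE k m) : ℝ)

/-- Spearman's In/Out rho computed from a given rank assignment `Rm` (ranks of
`D⁻(e_*)`) and `Rp` (ranks of `D⁺(e^*)`). -/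
noncomputable def rhoFromRanks {E : Type*} [Fintype E] (Rm Rp : E → ℝ) : ℝ :=
  (12 * ∑ e : E, Rm e * Rp e
      - 3 * (Fintype.card E : ℝ) * ((Fintype.card E : ℝ) + 1) ^ 2)
    / ((Fintype.card E : ℝ) ^ 3 - (Fintype.card E : ℝ))

/-- Index-order ranking of the in-degrees `D⁻(e_*)` of `G(n, an)`:
`R⁻((eᵢ)_*) = i`, `R⁻((fⱼ)_*) = n + j`, `R⁻(g_*) = 1 + (a+1)n`. -/
noncomputable def rMinusIdx (a n : ℕ) : BridgeE n (a * n) → ℝ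
  | Sum.inl i => (i : ℝ) + 1
  | Sum.inr (Sum.inl j) => (n : ℝ) + (j : ℝ) + 1
  | Sum.inr (Sum.inr _) => 1 + ((a : ℝ) + 1) * n

/-- Index-order ranking of the out-degrees `D⁺(e^*)` of `G(n, an)`:
`R⁺((eᵢ)^*) = an + i`, `R⁺((fⱼ)^*) = j`, `R⁺(g^*) = 1 + (a+1)n`. -/
noncomputable def rPlusIdx (a n : ℕ) : BridgeE n (a * n) → ℝ
  | Sum.inl i => (a : ℝ) * n + (i : ℝ) + 1
  | Sum.inr (Sum.inl j) => (j : ℝ) + 1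
  | Sum.inr (Sum.inr _) => 1 + ((a : ℝ) + 1) * n

theorem sum_fin_succ_mul_add_succ (c : ℕ) (x : ℝ) :
    ∑ i : Fin c, ((i : ℝ) + 1) * (x + (i : ℝ) + 1) =
      c * (c + 1) * (2 * c + 1) / 6 + x * (c * (c + 1) / 2) := by
  induction c with
  | zero => simp
  | succ c ih =>
    rw [Fin.sum_univ_castSucc]
    simp only [Fin.val_castSucc, Fin.val_last]
    rw [ih]
    push_cast
    ring

theorem sum_rMinusIdx_mul_rPlusIdx (a n : ℕ) :
    ∑ e, rMinusIdx a n e * rPlusIdx a n e =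
      ((n : ℝ) * (n + 1) * (2 * n + 1) / 6 + a * n * (n * (n + 1) / 2)) +
        ((a * n : ℝ) * (a * n + 1) * (2 * (a * n) + 1) / 6 + n * (a * n * (a * n + 1) / 2)) +
        (1 + ((a : ℝ) + 1) * n) ^ 2 := by
  have h := sum_fin_succ_mul_add_succ (a * n) n
  push_cast at h
  simp only [Fintype.sum_sum_type, rMinusIdx, rPlusIdx, Finset.univ_unique, Finset.sum_singleton]
  rw [sum_fin_succ_mul_add_succ, ← h]
  simp only [mul_comm ((n : ℝ) + _ + 1)]
  ring

theorem rhoFromRanks_rMinusIdx_rPlusIdx (a n : ℕ) :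
    rhoFromRanks (rMinusIdx a n) (rPlusIdx a n) =
      (((a : ℝ) ^ 3 - 3 * a ^ 2 - 3 * a + 1) * n ^ 3
          + 3 * ((a : ℝ) + 1) ^ 2 * n ^ 2 + 2 * ((a : ℝ) + 1) * n) /
        (((a : ℝ) ^ 3 + 3 * a ^ 2 + 3 * a + 1) * n ^ 3
          + 3 * ((a : ℝ) + 1) ^ 2 * n ^ 2 + 2 * ((a : ℝ) + 1) * n) := by
  have hcard : (Fintype.card (BridgeE n (a * n)) : ℝ) = n + (a * n + 1) := by
    simp
  rw [rhoFromRanks, sum_rMinusIdx_mul_rPlusIdx, hcard]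
  congr 1 <;> ring

/-- A ratio of two cubics without constant term tends to the ratio of the leading coefficients. -/
theorem tendsto_cubic_div_cubic {p q b c : ℝ} (hq : q ≠ 0) :
    Tendsto (fun n : ℕ => (p * (n : ℝ) ^ 3 + b * n ^ 2 + c * n) /
      (q * (n : ℝ) ^ 3 + b * n ^ 2 + c * n)) atTop (𝓝 (p / q)) := by
  have hinv : Tendsto (fun n : ℕ => ((n : ℝ))⁻¹) atTop (𝓝 0) := tendsto_inv_atTop_nhds_zero_nat
  have hcubic (r : ℝ) :
      Tendsto (fun n : ℕ => r + b * (n : ℝ)⁻¹ + c * (n : ℝ)⁻¹ ^ 2) atTop (𝓝 r) := by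
    simpa using (tendsto_const_nhds.add (hinv.const_mul b)).add ((hinv.pow 2).const_mul c)
  refine ((hcubic p).div (hcubic q) hq).congr' ?_
  filter_upwards [eventually_ge_atTop 1] with n hn
  have hn0 : (n : ℝ) ≠ 0 := by positivity
  have hfactor (r : ℝ) : r * (n : ℝ) ^ 3 + b * n ^ 2 + c * n =
      (r + b * (n : ℝ)⁻¹ + c * (n : ℝ)⁻¹ ^ 2) * (n : ℝ) ^ 3 := by
    field_simp
  simp only [Pi.div_apply]
  rw [hfactor, hfactor, mul_div_mul_right _ _ (pow_ne_zero 3 hn0)]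

/-- For the in-out bridge graphs `Gₙᵃ = G(n, an)` with `a ≥ 1` fixed and ties
resolved by the index-order ranking, Spearman's In/Out rho equals the explicit
rational expression and tends to `(a³ − 3a² − 3a + 1)/(a+1)³`. -/
theorem spearman_index_order_in_out_bridge (a : ℕ) (ha : 1 ≤ a) :
    (∀ n : ℕ, 1 ≤ n →
      rhoFromRanks (rMinusIdx a n) (rPlusIdx a n) =
        (((a : ℝ) ^ 3 - 3 * a ^ 2 - 3 * a + 1) * n ^ 3
            + 3 * ((a : ℝ) + 1) ^ 2 * n ^ 2 + 2 * ((a : ℝ) + 1) * n) /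
          (((a : ℝ) ^ 3 + 3 * a ^ 2 + 3 * a + 1) * n ^ 3
            + 3 * ((a : ℝ) + 1) ^ 2 * n ^ 2 + 2 * ((a : ℝ) + 1) * n)) ∧
    Tendsto (fun n : ℕ => rhoFromRanks (rMinusIdx a n) (rPlusIdx a n)) atTop
      (𝓝 (((a : ℝ) ^ 3 - 3 * a ^ 2 - 3 * a + 1) / ((a : ℝ) + 1) ^ 3)) := by
  refine ⟨fun n _ => rhoFromRanks_rMinusIdx_rPlusIdx a n, ?_⟩
  simp only [rhoFromRanks_rMinusIdx_rPlusIdx]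
  have hexpand : ((a : ℝ) + 1) ^ 3 = (a : ℝ) ^ 3 + 3 * a ^ 2 + 3 * a + 1 := by ring
  rw [hexpand]
  exact tendsto_cubic_div_cubic (by positivity)
end
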